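/- Let k ≥ 2 be an integer and let j with 0 < j ≤ 2^(k−1). Write j − 1 = a_{k−1}·2^(k−2) + ⋯ + a_1·2^0 in binary (a_i ∈ {0,1}), and let C be the set of even-weight vertices of Q_k that either equal 0^k or have 0^(k−1−i)1 as a prefix for some i with a_i = 1. Then |C| = j, and the graph obtained from Q_k by deleting C contains a path of length 2^k − 2j. -/

import Mathlib

open SimpleGraph

/-- The hypercube graph `Q_n` on vertex set `{0,1}^n`: two vertices are adjacent
iff they differ in exactly one coordinate. -/
def hypercube (n : ℕ) : SimpleGraph (Fin n → Bool) :=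
  SimpleGraph.fromRel (fun u v => hammingDist u v = 1)

/-- `HasCopy H G` means `H` contains a subgraph isomorphic to `G`. -/
def HasCopy {V W : Type*} (H : SimpleGraph V) (G : SimpleGraph W) : Prop :=
  ∃ f : G →g H, Function.Injective f

/-- `IsSat Host H G`: `H` is an `(Host, G)`-saturated subgraph of `Host`. -/
def IsSat {V W : Type*} (Host H : SimpleGraph V) (G : SimpleGraph W) : Prop :=
  H ≤ Host ∧ ¬ HasCopy H G ∧
    ∀ u v : V, Host.Adj u v → ¬ H.Adj u v →
      HasCopy (H ⊔ SimpleGraph.fromEdgeSet {s(u, v)}) G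

/-- The saturation number `sat(Host, G)`. -/
noncomputable def satNum {V W : Type*} (Host : SimpleGraph V) (G : SimpleGraph W) : ℕ :=
  sInf { m | ∃ H : SimpleGraph V, IsSat Host H G ∧ H.edgeSet.ncard = m }

/-- The weight of a vertex of the hypercube: its number of `1` coordinates. -/
def wt {k : ℕ} (v : Fin k → Bool) : ℕ := (Finset.univ.filter (fun i => v i = true)).card

/-- `hasPrefix v s`: the first `s` coordinates of `v` are `0` and, if `s < k`,
coordinate `s` (0-based) is `1`; i.e. `v` has the string `0^s 1` as a prefix. -/
def hasPrefixZeroOne {k : ℕ} (v : Fin k → Bool) (s : ℕ) : Prop :=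
  ∀ t : Fin k, ((t : ℕ) < s → v t = false) ∧ ((t : ℕ) = s → v t = true)

/-- The set `C` of the paper (Lemma on maximal paths): writing
`j - 1 = a_{k-1}·2^{k-2} + ⋯ + a_1·2^0` in binary, so `a_i = testBit (j-1) (i-1)`,
`C` consists of the even-weight vertices that are `0^k` or have prefix
`0^(k-1-i)1` for some `i` with `a_i = 1`. -/
def paperC (k j : ℕ) : Set (Fin k → Bool) :=
  { v | wt v % 2 = 0 ∧
      ((∀ t : Fin k, v t = false) ∨
        ∃ i : ℕ, 1 ≤ i ∧ i ≤ k - 1 ∧ Nat.testBit (j - 1) (i - 1) = true ∧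
          hasPrefixZeroOne v (k - 1 - i)) }

lemma card_filter_fin_succ {n : ℕ} (p : Fin (n + 1) → Prop) [DecidablePred p] :
    (Finset.univ.filter p).card =
      (if p 0 then 1 else 0) + (Finset.univ.filter fun i : Fin n => p i.succ).card := by
  simp only [Finset.card_filter, Fin.sum_univ_succ]

lemma wt_cons {n : ℕ} (b : Bool) (v : Fin n → Bool) :
    wt (Fin.cons b v : Fin (n + 1) → Bool) = b.toNat + wt v := by
  unfold wt
  rw [card_filter_fin_succ]
  cases b <;> simp

lemma hypercube_adj {n : ℕ} (u v : Fin n → Bool) :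
    (hypercube n).Adj u v ↔ hammingDist u v = 1 := by
  simp only [hypercube, SimpleGraph.fromRel_adj, hammingDist_comm v u, or_self, and_iff_right_iff_imp]
  rintro h rfl
  simp at h

lemma hammingDist_cons {n : ℕ} (a b : Bool) (u v : Fin n → Bool) :
    hammingDist (Fin.cons a u : Fin (n + 1) → Bool) (Fin.cons b v) =
      (if a ≠ b then 1 else 0) + hammingDist u v := by
  unfold hammingDist
  rw [card_filter_fin_succ]
  simp

/-- The embedding of `Q_n` into `Q_{n+1}` as the subcube with first coordinate `b`. -/
def consHom (n : ℕ) (b : Bool) : hypercube n →g hypercube (n + 1) where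
  toFun v := Fin.cons b v
  map_rel' {u v} h := by
    rw [hypercube_adj] at h ⊢
    simp [hammingDist_cons, h]

lemma consHom_injective (n : ℕ) (b : Bool) : Function.Injective (consHom n b) :=
  Fin.cons_right_injective (α := fun _ => Bool) b

/-- Paths in the two halves of `Q_{n+1}`, the second starting above the end of the first,
join to a path. -/
lemma exists_isPath_join {n : ℕ} (b : Bool) {x y z : Fin n → Bool}
    {p : (hypercube n).Walk x y} {q : (hypercube n).Walk y z} (hp : p.IsPath) (hq : q.IsPath) :
    ∃ r : (hypercube (n + 1)).Walk (consHom n b x) (consHom n (!b) z), r.IsPath ∧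
      r.length = p.length + q.length + 1 ∧
      ∀ v ∈ r.support, (∃ u ∈ p.support, consHom n b u = v) ∨ ∃ u, consHom n (!b) u = v := by
  have hadj : (hypercube (n + 1)).Adj (consHom n b y) (consHom n (!b) y) := by
    rw [hypercube_adj]
    simp [consHom, hammingDist_cons]
  have hs : ((p.map (consHom n b)).append (.cons hadj (q.map (consHom n (!b))))).support =
      p.support.map (consHom n b) ++ q.support.map (consHom n (!b)) := by
    simp [Walk.support_append]
  refine ⟨(p.map (consHom n b)).append (.cons hadj (q.map (consHom n (!b)))), ?_, ?_, ?_⟩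
  · refine Walk.IsPath.mk' ?_
    rw [hs, List.nodup_append]
    refine ⟨hp.support_nodup.map (consHom_injective n b),
      hq.support_nodup.map (consHom_injective n _), ?_⟩
    simp only [List.mem_map]
    rintro _ ⟨u, -, rfl⟩ _ ⟨v, -, rfl⟩ h
    have := congrFun h 0
    simp [consHom] at this
  · simp [Walk.length_append]
    omega
  · intro v hv
    rw [hs, List.mem_append, List.mem_map, List.mem_map] at hv
    rcases hv with ⟨u, hu, h⟩ | ⟨u, -, h⟩
    · exact Or.inl ⟨u, hu, h⟩
    · exact Or.inr ⟨u, h⟩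

/-- `Q_n` has a Hamiltonian path starting at any given vertex. -/
lemma exists_hamiltonian_isPath (n : ℕ) (x : Fin n → Bool) :
    ∃ (y : Fin n → Bool) (p : (hypercube n).Walk x y), p.IsPath ∧ p.length + 1 = 2 ^ n := by
  induction n with
  | zero => exact ⟨x, .nil, .nil, rfl⟩
  | succ n ih =>
    obtain ⟨y, p, hp, hpl⟩ := ih (Fin.tail x)
    obtain ⟨z, q, hq, hql⟩ := ih y
    obtain ⟨r, hr, hrl, -⟩ := exists_isPath_join (x 0) hp hq
    have hx : consHom n (x 0) (Fin.tail x) = x := Fin.cons_self_tail x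
    rw [← hx]
    exact ⟨_, r, hr, by rw [pow_succ]; omega⟩

lemma ncard_eq_ncard_cons {n : ℕ} (S : Set (Fin (n + 1) → Bool)) :
    S.ncard = {v : Fin n → Bool | Fin.cons false v ∈ S}.ncard +
      {v : Fin n → Bool | Fin.cons true v ∈ S}.ncard := by
  have h : S = consHom n false '' {v | Fin.cons false v ∈ S} ∪
      consHom n true '' {v | Fin.cons true v ∈ S} := by
    ext v
    cases v using Fin.consCases with
    | cons b v => cases b <;> simp [consHom, Fin.cons_inj]
  conv_lhs => rw [h]
  rw [Set.ncard_union_eq, Set.ncard_image_of_injective _ (consHom_injective n _),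
    Set.ncard_image_of_injective _ (consHom_injective n _)]
  rw [Set.disjoint_left]
  rintro _ ⟨u, -, rfl⟩ ⟨v, -, h⟩
  have := congrFun h 0
  simp [consHom] at this

lemma ncard_wt_mod_two (n : ℕ) (r : ℕ) (hr : r < 2) :
    {v : Fin (n + 1) → Bool | wt v % 2 = r}.ncard = 2 ^ n := by
  induction n generalizing r with
  | zero =>
    rw [ncard_eq_ncard_cons]
    have h (v : Fin 0 → Bool) : wt v = 0 := by simp [wt]
    interval_cases r <;> simp [wt_cons, h]
  | succ n ih =>
    rw [ncard_eq_ncard_cons]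
    have h (v : Fin (n + 1) → Bool) : (1 + wt v) % 2 = r ↔ wt v % 2 = 1 - r := by omega
    simp [wt_cons, h, ih r hr, ih (1 - r) (by omega)]
    ring

lemma hasPrefixZeroOne_cons_zero {n : ℕ} (b : Bool) (v : Fin n → Bool) :
    hasPrefixZeroOne (Fin.cons b v : Fin (n + 1) → Bool) 0 ↔ b = true := by
  simp [hasPrefixZeroOne]

lemma hasPrefixZeroOne_cons_succ {n : ℕ} (b : Bool) (v : Fin n → Bool) (s : ℕ) :
    hasPrefixZeroOne (Fin.cons b v : Fin (n + 1) → Bool) (s + 1) ↔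
      b = false ∧ hasPrefixZeroOne v s := by
  simp [hasPrefixZeroOne, Fin.forall_fin_succ]

lemma cons_true_mem_paperC {n m : ℕ} (v : Fin (n + 1) → Bool) :
    (Fin.cons true v : Fin (n + 2) → Bool) ∈ paperC (n + 2) (m + 1) ↔
      wt v % 2 = 1 ∧ m.testBit n = true := by
  have hw : (1 + wt v) % 2 = 0 ↔ wt v % 2 = 1 := by omega
  simp only [paperC, Set.mem_ofPred_eq, wt_cons, Bool.toNat_true, hw, and_congr_right_iff]
  rintro -
  constructor
  · rintro (h | ⟨i, hi, hin, hb, hp⟩)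
    · simpa using h 0
    · obtain h | h := Nat.lt_or_ge i (n + 1)
      · obtain ⟨s, hs⟩ : ∃ s, n + 2 - 1 - i = s + 1 := ⟨n - i, by omega⟩
        rw [hs, hasPrefixZeroOne_cons_succ] at hp
        simp at hp
      · obtain rfl : i = n + 1 := by omega
        simpa using hb
  · intro h
    refine Or.inr ⟨n + 1, by omega, by omega, by simpa using h, ?_⟩
    simp [hasPrefixZeroOne_cons_zero]

lemma cons_false_mem_paperC {n m m' : ℕ} (h : ∀ i < n, m.testBit i = m'.testBit i)
    (v : Fin (n + 1) → Bool) :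
    (Fin.cons false v : Fin (n + 2) → Bool) ∈ paperC (n + 2) (m + 1) ↔
      v ∈ paperC (n + 1) (m' + 1) := by
  simp only [paperC, Set.mem_ofPred_eq, wt_cons, Bool.toNat_false, zero_add, Fin.forall_fin_succ,
    Fin.cons_zero, Fin.cons_succ, true_and, Nat.add_sub_cancel]
  refine and_congr_right fun _ => or_congr_right (exists_congr fun i => ?_)
  constructor
  · rintro ⟨hi, hin, hb, hp⟩
    obtain hlt | hge := Nat.lt_or_ge i (n + 1)
    · rw [show n + 2 - 1 - i = n - i + 1 by omega, hasPrefixZeroOne_cons_succ] at hp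
      exact ⟨hi, by omega, by rwa [← h _ (by omega)], hp.2⟩
    · rw [show n + 2 - 1 - i = 0 by omega, hasPrefixZeroOne_cons_zero] at hp
      simp at hp
  · rintro ⟨hi, hin, hb, hp⟩
    refine ⟨hi, by omega, by rwa [h _ (by omega)], ?_⟩
    rw [show n + 2 - 1 - i = n - i + 1 by omega, hasPrefixZeroOne_cons_succ]
    exact ⟨rfl, hp⟩

lemma paperC_one : paperC 1 1 = {v | wt v % 2 = 0} := by
  ext v
  simp only [paperC, Set.mem_ofPred_eq, and_iff_left_iff_imp]
  intro h
  left
  cases v using Fin.consCases with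
  | cons b v =>
    have hv : wt v = 0 := by simp [wt]
    cases b <;> simp_all [wt_cons]

lemma ncard_paperC (n m : ℕ) (hm : m < 2 ^ n) : (paperC (n + 1) (m + 1)).ncard = m + 1 := by
  induction n generalizing m with
  | zero =>
    obtain rfl : m = 0 := by simpa using hm
    simpa [paperC_one] using ncard_wt_mod_two 0 0 (by omega)
  | succ n ih =>
    rw [ncard_eq_ncard_cons]
    simp only [cons_true_mem_paperC]
    obtain h | h := Nat.lt_or_ge m (2 ^ n)
    · simp [cons_false_mem_paperC fun _ _ => rfl, ih m h, Nat.testBit_lt_two_pow h]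
    · obtain ⟨m, rfl⟩ := Nat.exists_eq_add_of_le h
      have hm' : m < 2 ^ n := by rw [pow_succ] at hm; omega
      simp [cons_false_mem_paperC (fun i hi => Nat.testBit_two_pow_add_gt hi m), ih m hm',
        Nat.testBit_two_pow_add_eq, Nat.testBit_lt_two_pow hm', ncard_wt_mod_two]
      omega

lemma exists_isPath_avoiding_paperC (n m : ℕ) (hm : m < 2 ^ n) :
    ∃ (x y : Fin (n + 1) → Bool) (p : (hypercube (n + 1)).Walk x y), p.IsPath ∧
      p.length + 2 * (m + 1) = 2 ^ (n + 1) ∧ ∀ v ∈ p.support, v ∉ paperC (n + 1) (m + 1) := by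
  induction n generalizing m with
  | zero =>
    obtain rfl : m = 0 := by simpa using hm
    refine ⟨fun _ => true, _, .nil, .nil, rfl, ?_⟩
    simp [paperC_one, wt]
  | succ n ih =>
    obtain h | h := Nat.lt_or_ge m (2 ^ n)
    · obtain ⟨x, y, p, hp, hpl, hps⟩ := ih m h
      obtain ⟨z, q, hq, hql⟩ := exists_hamiltonian_isPath (n + 1) y
      obtain ⟨r, hr, hrl, hrs⟩ := exists_isPath_join false hp hq
      refine ⟨_, _, r, hr, by rw [pow_succ 2 (n + 1)]; omega, fun v hv => ?_⟩
      obtain ⟨u, hu, rfl⟩ | ⟨u, rfl⟩ := hrs v hv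
      · exact (cons_false_mem_paperC (fun _ _ => rfl) u).not.2 (hps u hu)
      · exact (cons_true_mem_paperC u).not.2 (by simp [Nat.testBit_lt_two_pow h])
    · obtain ⟨m, rfl⟩ := Nat.exists_eq_add_of_le h
      obtain ⟨x, y, p, hp, hpl, hps⟩ := ih m (by rw [pow_succ] at hm; omega)
      refine ⟨_, _, p.map (consHom _ false), hp.map (consHom_injective _ _),
        by rw [Walk.length_map]; rw [pow_succ] at hpl ⊢; rw [pow_succ]; omega, fun v hv => ?_⟩
      rw [Walk.support_map, List.mem_map] at hv
      obtain ⟨u, hu, rfl⟩ := hv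
      exact (cons_false_mem_paperC (fun i hi => Nat.testBit_two_pow_add_gt hi m) u).not.2 (hps u hu)

/-- the set `C = paperC k j` consists of exactly `j` even-weight
vertices, and `Q_k` with `C` deleted contains a path of length `2^k - 2j`. -/
theorem stmt19 (k j : ℕ) (hk : 2 ≤ k) (hj0 : 0 < j) (hj : j ≤ 2 ^ (k - 1)) :
    (paperC k j).ncard = j ∧
      ∃ (x y : ↥((paperC k j)ᶜ))
        (p : ((hypercube k).induce (paperC k j)ᶜ).Walk x y),
        p.IsPath ∧ p.length = 2 ^ k - 2 * j := by
  obtain ⟨n, rfl⟩ : ∃ n, k = n + 1 := ⟨k - 1, by omega⟩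
  obtain ⟨m, rfl⟩ : ∃ m, j = m + 1 := ⟨j - 1, by omega⟩
  rw [Nat.add_sub_cancel] at hj
  obtain ⟨x, y, p, hp, hpl, hps⟩ := exists_isPath_avoiding_paperC n m hj
  have hps' : ∀ v ∈ p.support, v ∈ (paperC (n + 1) (m + 1))ᶜ := fun v hv =>
    Set.mem_compl (hps v hv)
  refine ⟨ncard_paperC n m hj, ⟨x, hps' x p.start_mem_support⟩,
    ⟨y, hps' y p.end_mem_support⟩, p.induce (paperC (n + 1) (m + 1))ᶜ hps', ?_, ?_⟩
  · refine Walk.IsPath.of_map (f := (Embedding.induce _).toHom) ?_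
    rwa [Walk.map_induce]
  · rw [← Walk.length_map (Embedding.induce _).toHom, Walk.map_induce]
    exact Nat.eq_sub_of_add_eq hpl
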